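/- Let X be an ℝ^d-valued Gaussian random vector with mean μ and symmetric positive definite covariance Σ, and set P := Σ⁻¹. Let M̄ and M̄^j be symmetric d×d matrices with P + M̄ positive definite, and let V̄, V̄^j ∈ ℝ^d. Define Λ := log E[exp(-(1/2) Xᵀ M̄ X + Xᵀ V̄)] and c := E[ ( (1/2) Xᵀ M̄^j X + Xᵀ V̄^j - (1/2) Xᵀ M̄ X + Xᵀ V̄ - Λ ) · exp(-(1/2) Xᵀ M̄ X + Xᵀ V̄) ] / E[exp(-(1/2) Xᵀ M̄ X + Xᵀ V̄)]. Then c = (1/2) log det(I_d + Σ M̄) - (1/2) Tr( (M̄ - M̄^j)(P + M̄)⁻¹ ) + V̄ᵀ (P + M̄)⁻¹ V̄^j + (1/2) V̄ᵀ (P + M̄)⁻¹ (P + M̄^j) (P + M̄)⁻¹ V̄ + μᵀ P (P + M̄)⁻¹ ( V̄^j - (M̄ - M̄^j)(P + M̄)⁻¹ V̄ ) + (1/2) μᵀ P (P + M̄)⁻¹ ( M̄ Σ M̄ + M̄^j ) (P + M̄)⁻¹ P μ. -/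

import Mathlib

open MeasureTheory ProbabilityTheory Matrix Filter

/-- The density of a `N(μ, S)` Gaussian on `ℝ^d` (with respect to Lebesgue measure). -/
noncomputable def gaussianPdf (d : ℕ) (μ : Fin d → ℝ) (S : Matrix (Fin d) (Fin d) ℝ)
    (x : Fin d → ℝ) : ℝ :=
  (Real.sqrt ((2 * Real.pi) ^ d * S.det))⁻¹ *
    Real.exp (-(1 / 2) * ((x - μ) ⬝ᵥ (S⁻¹ *ᵥ (x - μ))))

/-- `X` is a Gaussian random vector with mean `μ` and covariance matrix `S`. -/
def IsGaussianVec {Ω : Type*} [MeasurableSpace Ω] (P : Measure Ω) {d : ℕ}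
    (X : Ω → Fin d → ℝ) (μ : Fin d → ℝ) (S : Matrix (Fin d) (Fin d) ℝ) : Prop :=
  Measure.map X P = volume.withDensity fun x => ENNReal.ofReal (gaussianPdf d μ S x)

/-- The exponential-quadratic weight `exp(-(1/2) xᵀ M̄ x + xᵀ V̄)` evaluated at `X ω`. -/
noncomputable def gaussWeight {Ω : Type*} {d : ℕ} (X : Ω → Fin d → ℝ)
    (Mbar : Matrix (Fin d) (Fin d) ℝ) (Vbar : Fin d → ℝ) (ω : Ω) : ℝ :=
  Real.exp (-(1 / 2) * (X ω ⬝ᵥ (Mbar *ᵥ X ω)) + X ω ⬝ᵥ Vbar)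

lemma integrable_pow_mul_exp_neg_half_sq (n : ℕ) :
    Integrable fun x : ℝ => x ^ n * Real.exp (-(1 / 2) * x ^ 2) := by
  have h := integrable_rpow_mul_exp_neg_mul_sq (b := 1 / 2) (by norm_num) (s := n)
    (by linarith [n.cast_nonneg (α := ℝ)])
  simpa only [Real.rpow_natCast] using h

lemma integral_exp_neg_half_sq :
    ∫ x : ℝ, Real.exp (-(1 / 2) * x ^ 2) = √(2 * Real.pi) := by
  rw [integral_gaussian]
  congr 1
  ring

lemma integral_mul_exp_neg_half_sq :
    ∫ x : ℝ, x * Real.exp (-(1 / 2) * x ^ 2) = 0 := by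
  have h := integral_neg_eq_self (fun x : ℝ => x * Real.exp (-(1 / 2) * x ^ 2)) volume
  simp only [even_two.neg_pow, neg_mul (a := (_ : ℝ)) (b := Real.exp _), integral_neg] at h
  simp only [neg_mul] at h ⊢
  linarith

lemma integral_sq_mul_exp_neg_half_sq :
    ∫ x : ℝ, x ^ 2 * Real.exp (-(1 / 2) * x ^ 2) = √(2 * Real.pi) := by
  have h : ∫ x : ℝ, x ^ 2 ∂(gaussianReal 0 1) = 1 := by
    have h := variance_eq_sub (μ := gaussianReal 0 1) (memLp_id_gaussianReal (μ := 0) (v := 1) 2)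
    simpa using h.symm
  rw [integral_gaussianReal_eq_integral_smul one_ne_zero] at h
  have h2 : ∀ x : ℝ, gaussianPDFReal 0 1 x • x ^ 2
      = (√(2 * Real.pi))⁻¹ * (x ^ 2 * Real.exp (-(1 / 2) * x ^ 2)) := by
    intro x
    rw [gaussianPDFReal, smul_eq_mul, NNReal.coe_one, mul_one,
      show -(x - 0) ^ 2 / (2 * 1) = -(1 / 2) * x ^ 2 by ring]
    ring
  simp_rw [h2] at h
  rw [integral_const_mul, inv_mul_eq_one₀ (by positivity)] at h
  exact h.symm

section StandardGaussian

variable {d : ℕ}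

lemma prod_pow_mul_exp_neg_half (n : Fin d → ℕ) (y : Fin d → ℝ) :
    (∏ k, y k ^ n k) * Real.exp (-(1 / 2) * (y ⬝ᵥ y))
      = ∏ k, (y k ^ n k * Real.exp (-(1 / 2) * y k ^ 2)) := by
  rw [Finset.prod_mul_distrib, ← Real.exp_sum, dotProduct, Finset.mul_sum]
  simp only [pow_two]

lemma integrable_prod_pow_mul_exp (n : Fin d → ℕ) :
    Integrable fun y : Fin d → ℝ => (∏ k, y k ^ n k) * Real.exp (-(1 / 2) * (y ⬝ᵥ y)) := by
  simp_rw [prod_pow_mul_exp_neg_half]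
  exact Integrable.fintype_prod (f := fun k (x : ℝ) => x ^ n k * Real.exp (-(1 / 2) * x ^ 2))
    fun k => integrable_pow_mul_exp_neg_half_sq (n k)

lemma integral_prod_pow_mul_exp (n : Fin d → ℕ) :
    ∫ y : Fin d → ℝ, (∏ k, y k ^ n k) * Real.exp (-(1 / 2) * (y ⬝ᵥ y))
      = ∏ k, ∫ x : ℝ, x ^ n k * Real.exp (-(1 / 2) * x ^ 2) := by
  simp_rw [prod_pow_mul_exp_neg_half]
  exact integral_fintype_prod_volume_eq_prod
    fun k (x : ℝ) => x ^ n k * Real.exp (-(1 / 2) * x ^ 2)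

lemma prod_pow_single (i : Fin d) (y : Fin d → ℝ) :
    ∏ k, y k ^ (Pi.single i 1 : Fin d → ℕ) k = y i := by
  rw [Finset.prod_eq_single i] <;> simp +contextual

lemma prod_pow_single_add_single (i j : Fin d) (y : Fin d → ℝ) :
    ∏ k, y k ^ (Pi.single i 1 + Pi.single j 1 : Fin d → ℕ) k = y i * y j := by
  simp_rw [Pi.add_apply, pow_add, Finset.prod_mul_distrib, prod_pow_single]

lemma integrable_exp_neg_half_dotProduct :
    Integrable fun y : Fin d → ℝ => Real.exp (-(1 / 2) * (y ⬝ᵥ y)) := by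
  simpa using integrable_prod_pow_mul_exp (0 : Fin d → ℕ)

lemma integral_exp_neg_half_dotProduct :
    ∫ y : Fin d → ℝ, Real.exp (-(1 / 2) * (y ⬝ᵥ y)) = √(2 * Real.pi) ^ d := by
  have h := integral_prod_pow_mul_exp (0 : Fin d → ℕ)
  simp only [Pi.zero_apply, pow_zero, Finset.prod_const_one, one_mul, integral_exp_neg_half_sq,
    Finset.prod_const, Finset.card_univ, Fintype.card_fin] at h
  exact h

lemma integrable_apply_mul_exp (i : Fin d) :
    Integrable fun y : Fin d → ℝ => y i * Real.exp (-(1 / 2) * (y ⬝ᵥ y)) := by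
  simpa only [prod_pow_single] using integrable_prod_pow_mul_exp (Pi.single i 1 : Fin d → ℕ)

lemma integral_apply_mul_exp (i : Fin d) :
    ∫ y : Fin d → ℝ, y i * Real.exp (-(1 / 2) * (y ⬝ᵥ y)) = 0 := by
  have h := integral_prod_pow_mul_exp (Pi.single i 1 : Fin d → ℕ)
  simp only [prod_pow_single] at h
  rw [h]
  refine Finset.prod_eq_zero (Finset.mem_univ i) ?_
  simpa only [Pi.single_eq_same, pow_one] using integral_mul_exp_neg_half_sq

lemma integrable_apply_mul_apply_mul_exp (i j : Fin d) :
    Integrable fun y : Fin d → ℝ => y i * y j * Real.exp (-(1 / 2) * (y ⬝ᵥ y)) := by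
  have h := integrable_prod_pow_mul_exp (Pi.single i 1 + Pi.single j 1 : Fin d → ℕ)
  simp only [prod_pow_single_add_single] at h
  exact h

lemma integral_apply_mul_apply_mul_exp (i j : Fin d) :
    ∫ y : Fin d → ℝ, y i * y j * Real.exp (-(1 / 2) * (y ⬝ᵥ y))
      = if i = j then √(2 * Real.pi) ^ d else 0 := by
  have h := integral_prod_pow_mul_exp (Pi.single i 1 + Pi.single j 1 : Fin d → ℕ)
  simp only [prod_pow_single_add_single] at h
  rw [h]
  split_ifs with hij
  · subst hij
    rw [← Fin.prod_const]
    refine Finset.prod_congr rfl fun k _ => ?_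
    rcases eq_or_ne k i with rfl | hk
    · simpa [← two_mul] using integral_sq_mul_exp_neg_half_sq
    · simpa [hk] using integral_exp_neg_half_sq
  · refine Finset.prod_eq_zero (Finset.mem_univ i) ?_
    simpa [hij] using integral_mul_exp_neg_half_sq

lemma integral_quadratic_mul_exp (a : ℝ) (b : Fin d → ℝ) (A : Matrix (Fin d) (Fin d) ℝ) :
    ∫ y : Fin d → ℝ, (a + y ⬝ᵥ b + 1 / 2 * (y ⬝ᵥ (A *ᵥ y))) * Real.exp (-(1 / 2) * (y ⬝ᵥ y))
      = √(2 * Real.pi) ^ d * (a + 1 / 2 * A.trace) := by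
  have hexp : ∀ y : Fin d → ℝ,
      (a + y ⬝ᵥ b + 1 / 2 * (y ⬝ᵥ (A *ᵥ y))) * Real.exp (-(1 / 2) * (y ⬝ᵥ y))
        = a * Real.exp (-(1 / 2) * (y ⬝ᵥ y))
          + ∑ i, b i * (y i * Real.exp (-(1 / 2) * (y ⬝ᵥ y)))
          + ∑ i, ∑ j, 1 / 2 * A i j * (y i * y j * Real.exp (-(1 / 2) * (y ⬝ᵥ y))) := by
    intro y
    generalize Real.exp (-(1 / 2) * (y ⬝ᵥ y)) = e
    simp only [dotProduct, mulVec, add_mul, Finset.sum_mul, Finset.mul_sum]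
    congr 1
    · congr 1
      exact Finset.sum_congr rfl fun i _ => by ring
    · exact Finset.sum_congr rfl fun i _ => Finset.sum_congr rfl fun j _ => by ring
  have h0 := (integrable_exp_neg_half_dotProduct (d := d)).const_mul a
  have h1 : ∀ i ∈ Finset.univ, Integrable fun y : Fin d → ℝ =>
      b i * (y i * Real.exp (-(1 / 2) * (y ⬝ᵥ y))) :=
    fun i _ => (integrable_apply_mul_exp i).const_mul _
  have h2 : ∀ i, ∀ j ∈ Finset.univ, Integrable fun y : Fin d → ℝ =>
      1 / 2 * A i j * (y i * y j * Real.exp (-(1 / 2) * (y ⬝ᵥ y))) :=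
    fun i j _ => (integrable_apply_mul_apply_mul_exp i j).const_mul _
  have h3 : ∀ i ∈ Finset.univ, Integrable fun y : Fin d → ℝ =>
      ∑ j, 1 / 2 * A i j * (y i * y j * Real.exp (-(1 / 2) * (y ⬝ᵥ y))) :=
    fun i _ => integrable_finsetSum _ (h2 i)
  have h01 : Integrable fun y : Fin d → ℝ => a * Real.exp (-(1 / 2) * (y ⬝ᵥ y))
      + ∑ i, b i * (y i * Real.exp (-(1 / 2) * (y ⬝ᵥ y))) :=
    h0.add (integrable_finsetSum _ h1)
  simp_rw [hexp]
  rw [integral_add h01 (integrable_finsetSum _ h3),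
    integral_add h0 (integrable_finsetSum _ h1), integral_finsetSum _ h1, integral_finsetSum _ h3]
  simp_rw [fun i => integral_finsetSum _ (h2 i), integral_const_mul, integral_apply_mul_exp,
    integral_apply_mul_apply_mul_exp, integral_exp_neg_half_dotProduct]
  simp only [mul_zero, Finset.sum_const_zero, add_zero, mul_ite, Finset.sum_ite_eq,
    Finset.mem_univ, if_true, ← Finset.sum_mul, ← Finset.mul_sum, Matrix.trace, Matrix.diag]
  ring

end StandardGaussian

section GaussianIntegral

variable {d : ℕ}

lemma integral_eq_abs_det_mul_integral_affine (L : Matrix (Fin d) (Fin d) ℝ) (hL : L.det ≠ 0)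
    (m : Fin d → ℝ) {f : (Fin d → ℝ) → ℝ} (hf : Continuous f) :
    ∫ x, f x = |L.det| * ∫ y, f (m + L *ᵥ y) := by
  have hg : Continuous fun x => f (m + x) := by fun_prop
  have h := integral_map (μ := (volume : Measure (Fin d → ℝ))) (φ := toLin' L)
    (toLin' L).continuous_of_finiteDimensional.aemeasurable
    (f := fun x => f (m + x)) hg.aestronglyMeasurable
  rw [Real.map_matrix_volume_pi_eq_smul_volume_pi hL, integral_smul_measure,
    ENNReal.toReal_ofReal (abs_nonneg _), integral_add_left_eq_self f m] at h
  simp only [toLin'_apply, smul_eq_mul, abs_inv] at h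
  rw [← h, mul_inv_cancel_left₀ (abs_ne_zero.mpr hL)]

lemma dotProduct_mulVec_add_mulVec (A L : Matrix (Fin d) (Fin d) ℝ) (m y : Fin d → ℝ) :
    (m + L *ᵥ y) ⬝ᵥ (A *ᵥ (m + L *ᵥ y))
      = m ⬝ᵥ (A *ᵥ m) + y ⬝ᵥ (Lᵀ *ᵥ ((A + Aᵀ) *ᵥ m)) + y ⬝ᵥ ((Lᵀ * A * L) *ᵥ y) := by
  have h1 : ∀ u : Fin d → ℝ, (L *ᵥ y) ⬝ᵥ u = y ⬝ᵥ (Lᵀ *ᵥ u) := fun u => by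
    rw [dotProduct_mulVec, vecMul_transpose]
  have h2 : m ⬝ᵥ (A *ᵥ (L *ᵥ y)) = (L *ᵥ y) ⬝ᵥ (Aᵀ *ᵥ m) := by
    rw [dotProduct_mulVec, dotProduct_comm, mulVec_transpose]
  rw [mulVec_add, add_dotProduct, dotProduct_add, dotProduct_add, h2, h1, h1, h1, add_mulVec,
    mulVec_add, dotProduct_add, ← mulVec_mulVec, ← mulVec_mulVec]
  ring

lemma Matrix.PosDef.exists_factor_inv {Q : Matrix (Fin d) (Fin d) ℝ} (hQ : Q.PosDef) :
    ∃ L : Matrix (Fin d) (Fin d) ℝ, L.det ≠ 0 ∧ Lᵀ * Q * L = 1 ∧ L * Lᵀ = Q⁻¹ ∧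
      |L.det| = (√Q.det)⁻¹ := by
  obtain ⟨B, hB, hQB⟩ : ∃ B : Matrix (Fin d) (Fin d) ℝ, IsUnit B ∧ Q = star B * B := by
    open scoped MatrixOrder Matrix.Norms.L2Operator in
    exact CStarAlgebra.isStrictlyPositive_iff_eq_star_mul_self.mp hQ.isStrictlyPositive
  rw [star_eq_conjTranspose, conjTranspose_eq_transpose_of_trivial] at hQB
  have hdet : IsUnit B.det := (isUnit_iff_isUnit_det B).mp hB
  refine ⟨B⁻¹, ?_, ?_, ?_, ?_⟩
  · rw [det_nonsing_inv, Ring.inverse_eq_inv']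
    exact inv_ne_zero hdet.ne_zero
  · rw [hQB, ← mul_assoc, ← transpose_mul, mul_assoc, mul_nonsing_inv _ hdet, transpose_one,
      one_mul]
  · rw [hQB, mul_inv_rev, transpose_nonsing_inv]
  · rw [det_nonsing_inv, Ring.inverse_eq_inv', hQB, det_mul, det_transpose,
      Real.sqrt_mul_self_eq_abs, abs_inv]

lemma integral_quadratic_mul_exp_quadratic {Q : Matrix (Fin d) (Fin d) ℝ} (hQ : Q.PosDef)
    (h : Fin d → ℝ) (a : ℝ) (b : Fin d → ℝ) (A : Matrix (Fin d) (Fin d) ℝ) :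
    ∫ x : Fin d → ℝ, (a + x ⬝ᵥ b + 1 / 2 * (x ⬝ᵥ (A *ᵥ x))) *
        Real.exp (-(1 / 2) * (x ⬝ᵥ (Q *ᵥ x)) + x ⬝ᵥ h)
      = √(2 * Real.pi) ^ d * (√Q.det)⁻¹ * Real.exp (1 / 2 * (h ⬝ᵥ (Q⁻¹ *ᵥ h))) *
        (a + (Q⁻¹ *ᵥ h) ⬝ᵥ b + 1 / 2 * ((Q⁻¹ *ᵥ h) ⬝ᵥ (A *ᵥ (Q⁻¹ *ᵥ h)))
          + 1 / 2 * (A * Q⁻¹).trace) := by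
  obtain ⟨L, hL, hLQ, hLL, hLdet⟩ := hQ.exists_factor_inv
  have hsymm : Qᵀ = Q := by
    rw [← conjTranspose_eq_transpose_of_trivial]
    exact hQ.isHermitian
  set m := Q⁻¹ *ᵥ h with hm
  have hQm : Q *ᵥ m = h := by
    rw [hm, mulVec_mulVec, mul_nonsing_inv _ hQ.det_pos.ne'.isUnit, one_mulVec]
  have hlin : ∀ y v : Fin d → ℝ, (m + L *ᵥ y) ⬝ᵥ v = m ⬝ᵥ v + y ⬝ᵥ (Lᵀ *ᵥ v) := fun y v => by
    rw [add_dotProduct, dotProduct_mulVec y, vecMul_transpose]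
  have hexp : ∀ y : Fin d → ℝ,
      -(1 / 2) * ((m + L *ᵥ y) ⬝ᵥ (Q *ᵥ (m + L *ᵥ y))) + (m + L *ᵥ y) ⬝ᵥ h
        = 1 / 2 * (h ⬝ᵥ m) + -(1 / 2) * (y ⬝ᵥ y) := fun y => by
    rw [dotProduct_mulVec_add_mulVec, hlin, hLQ, hsymm, add_mulVec, hQm, one_mulVec, mulVec_add,
      dotProduct_add, dotProduct_comm h m]
    ring
  have htr : (Lᵀ * A * L).trace = (A * Q⁻¹).trace := by
    rw [mul_assoc, trace_mul_comm, mul_assoc, hLL]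
  have hint : ∀ y : Fin d → ℝ,
      (a + (m + L *ᵥ y) ⬝ᵥ b + 1 / 2 * ((m + L *ᵥ y) ⬝ᵥ (A *ᵥ (m + L *ᵥ y)))) *
        Real.exp (-(1 / 2) * ((m + L *ᵥ y) ⬝ᵥ (Q *ᵥ (m + L *ᵥ y))) + (m + L *ᵥ y) ⬝ᵥ h)
      = Real.exp (1 / 2 * (h ⬝ᵥ m)) *
        (((a + m ⬝ᵥ b + 1 / 2 * (m ⬝ᵥ (A *ᵥ m)))
          + y ⬝ᵥ (Lᵀ *ᵥ b + (1 / 2 : ℝ) • (Lᵀ *ᵥ ((A + Aᵀ) *ᵥ m)))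
          + 1 / 2 * (y ⬝ᵥ ((Lᵀ * A * L) *ᵥ y))) * Real.exp (-(1 / 2) * (y ⬝ᵥ y))) := fun y => by
    rw [hexp, Real.exp_add, hlin, dotProduct_mulVec_add_mulVec, dotProduct_add, dotProduct_smul,
      smul_eq_mul]
    ring
  rw [integral_eq_abs_det_mul_integral_affine L hL m (by fun_prop)]
  simp_rw [hint]
  rw [integral_const_mul, integral_quadratic_mul_exp, htr, hLdet]
  ring

lemma integral_exp_quadratic {Q : Matrix (Fin d) (Fin d) ℝ} (hQ : Q.PosDef) (h : Fin d → ℝ) :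
    ∫ x : Fin d → ℝ, Real.exp (-(1 / 2) * (x ⬝ᵥ (Q *ᵥ x)) + x ⬝ᵥ h)
      = √(2 * Real.pi) ^ d * (√Q.det)⁻¹ * Real.exp (1 / 2 * (h ⬝ᵥ (Q⁻¹ *ᵥ h))) := by
  simpa using integral_quadratic_mul_exp_quadratic hQ h 1 0 0

end GaussianIntegral

section LinearQuadratic

variable {d : ℕ}

lemma IsGaussianVec.integral_comp {Ω : Type*} [MeasurableSpace Ω] {P : Measure Ω}
    {X : Ω → Fin d → ℝ} {μ : Fin d → ℝ} {S : Matrix (Fin d) (Fin d) ℝ}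
    (hGauss : IsGaussianVec P X μ S) (hX : Measurable X) {F : (Fin d → ℝ) → ℝ}
    (hF : Continuous F) :
    ∫ ω, F (X ω) ∂P = ∫ x, gaussianPdf d μ S x * F x := by
  have hpdf : Continuous (gaussianPdf d μ S) := by
    unfold gaussianPdf
    fun_prop
  rw [← integral_map hX.aemeasurable hF.aestronglyMeasurable, hGauss,
    integral_withDensity_eq_integral_toReal_smul hpdf.measurable.ennreal_ofReal
      (ae_of_all _ fun _ => ENNReal.ofReal_lt_top)]
  refine integral_congr_ae (ae_of_all _ fun x => ?_)
  have hx : 0 ≤ gaussianPdf d μ S x := by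
    unfold gaussianPdf
    positivity
  simp only [ENNReal.toReal_ofReal hx, smul_eq_mul]

lemma Matrix.IsSymm.dotProduct_mulVec_comm {A : Matrix (Fin d) (Fin d) ℝ} (hA : A.IsSymm)
    (u v : Fin d → ℝ) : u ⬝ᵥ (A *ᵥ v) = v ⬝ᵥ (A *ᵥ u) := by
  rw [dotProduct_mulVec, dotProduct_comm, ← mulVec_transpose, hA.eq]

lemma Matrix.PosDef.isSymm {A : Matrix (Fin d) (Fin d) ℝ} (hA : A.PosDef) : A.IsSymm := by
  rw [IsSymm, ← conjTranspose_eq_transpose_of_trivial]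
  exact hA.isHermitian

lemma gaussianPdf_mul_exp_quadratic {S : Matrix (Fin d) (Fin d) ℝ} (hS : S.PosDef)
    (μ V x : Fin d → ℝ) (M : Matrix (Fin d) (Fin d) ℝ) :
    gaussianPdf d μ S x * Real.exp (-(1 / 2) * (x ⬝ᵥ (M *ᵥ x)) + x ⬝ᵥ V)
      = (√((2 * Real.pi) ^ d * S.det))⁻¹ * Real.exp (-(1 / 2) * (μ ⬝ᵥ (S⁻¹ *ᵥ μ))) *
        Real.exp (-(1 / 2) * (x ⬝ᵥ ((S⁻¹ + M) *ᵥ x)) + x ⬝ᵥ (V + S⁻¹ *ᵥ μ)) := by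
  rw [gaussianPdf, mul_assoc, mul_assoc, ← Real.exp_add, ← Real.exp_add]
  congr 2
  rw [mulVec_sub, dotProduct_sub, sub_dotProduct, sub_dotProduct,
    hS.inv.isSymm.dotProduct_mulVec_comm μ x, add_mulVec, dotProduct_add, dotProduct_add]
  ring

lemma det_mul_det_inv_add {S : Matrix (Fin d) (Fin d) ℝ} (hS : S.PosDef)
    (M : Matrix (Fin d) (Fin d) ℝ) : S.det * (S⁻¹ + M).det = (1 + S * M).det := by
  rw [← det_mul, mul_add, mul_nonsing_inv _ hS.det_pos.ne'.isUnit]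

lemma integral_gaussianPdf_mul_exp_quadratic {S : Matrix (Fin d) (Fin d) ℝ} (hS : S.PosDef)
    {M : Matrix (Fin d) (Fin d) ℝ} (hQ : (S⁻¹ + M).PosDef) (μ V : Fin d → ℝ) :
    ∫ x, gaussianPdf d μ S x * Real.exp (-(1 / 2) * (x ⬝ᵥ (M *ᵥ x)) + x ⬝ᵥ V)
      = (√(1 + S * M).det)⁻¹ * Real.exp (-(1 / 2) * (μ ⬝ᵥ (S⁻¹ *ᵥ μ))
        + 1 / 2 * ((V + S⁻¹ *ᵥ μ) ⬝ᵥ ((S⁻¹ + M)⁻¹ *ᵥ (V + S⁻¹ *ᵥ μ)))) := by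
  simp_rw [gaussianPdf_mul_exp_quadratic hS]
  rw [integral_const_mul, integral_exp_quadratic hQ, ← det_mul_det_inv_add hS,
    Real.sqrt_mul hS.det_pos.le, Real.sqrt_mul (by positivity), Real.exp_add, mul_inv, mul_inv]
  have hpow : √((2 * Real.pi) ^ d) = √(2 * Real.pi) ^ d := by
    rw [Real.sqrt_eq_iff_mul_self_eq (by positivity) (by positivity), ← mul_pow,
      Real.mul_self_sqrt (by positivity)]
  have hne : √(2 * Real.pi) ^ d ≠ 0 := by positivity
  rw [hpow]
  field_simp

lemma integral_gaussianPdf_mul_quadratic_mul_exp {S : Matrix (Fin d) (Fin d) ℝ} (hS : S.PosDef)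
    {M : Matrix (Fin d) (Fin d) ℝ} (hQ : (S⁻¹ + M).PosDef) (μ V : Fin d → ℝ)
    (a : ℝ) (b : Fin d → ℝ) (A : Matrix (Fin d) (Fin d) ℝ) :
    ∫ x, gaussianPdf d μ S x * ((a + x ⬝ᵥ b + 1 / 2 * (x ⬝ᵥ (A *ᵥ x))) *
        Real.exp (-(1 / 2) * (x ⬝ᵥ (M *ᵥ x)) + x ⬝ᵥ V))
      = (∫ x, gaussianPdf d μ S x * Real.exp (-(1 / 2) * (x ⬝ᵥ (M *ᵥ x)) + x ⬝ᵥ V)) *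
        (a + ((S⁻¹ + M)⁻¹ *ᵥ (V + S⁻¹ *ᵥ μ)) ⬝ᵥ b
          + 1 / 2 * (((S⁻¹ + M)⁻¹ *ᵥ (V + S⁻¹ *ᵥ μ)) ⬝ᵥ
            (A *ᵥ ((S⁻¹ + M)⁻¹ *ᵥ (V + S⁻¹ *ᵥ μ))))
          + 1 / 2 * (A * (S⁻¹ + M)⁻¹).trace) := by
  simp_rw [mul_left_comm (gaussianPdf d μ S _), gaussianPdf_mul_exp_quadratic hS,
    mul_left_comm _ ((√((2 * Real.pi) ^ d * S.det))⁻¹ * _)]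
  rw [integral_const_mul, integral_const_mul, integral_quadratic_mul_exp_quadratic hQ,
    integral_exp_quadratic hQ]
  ring

lemma tilted_quadratic_expansion {S : Matrix (Fin d) (Fin d) ℝ} (hS : S.PosDef)
    {M N : Matrix (Fin d) (Fin d) ℝ} (hM : M.IsSymm) (hN : N.IsSymm) (hQ : (S⁻¹ + M).PosDef)
    (μ V W : Fin d → ℝ) :
    ((S⁻¹ + M)⁻¹ *ᵥ (V + S⁻¹ *ᵥ μ)) ⬝ᵥ (W + V)
        + 1 / 2 * (((S⁻¹ + M)⁻¹ *ᵥ (V + S⁻¹ *ᵥ μ)) ⬝ᵥ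
          ((N - M) *ᵥ ((S⁻¹ + M)⁻¹ *ᵥ (V + S⁻¹ *ᵥ μ))))
        + 1 / 2 * (μ ⬝ᵥ (S⁻¹ *ᵥ μ))
        - 1 / 2 * ((V + S⁻¹ *ᵥ μ) ⬝ᵥ ((S⁻¹ + M)⁻¹ *ᵥ (V + S⁻¹ *ᵥ μ)))
      = V ⬝ᵥ ((S⁻¹ + M)⁻¹ *ᵥ W)
        + 1 / 2 * (V ⬝ᵥ (((S⁻¹ + M)⁻¹ * (S⁻¹ + N) * (S⁻¹ + M)⁻¹) *ᵥ V))
        + μ ⬝ᵥ ((S⁻¹ * (S⁻¹ + M)⁻¹) *ᵥ (W - ((M - N) * (S⁻¹ + M)⁻¹) *ᵥ V))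
        + 1 / 2 * (μ ⬝ᵥ ((S⁻¹ * (S⁻¹ + M)⁻¹ * (M * S * M + N) * (S⁻¹ + M)⁻¹ * S⁻¹) *ᵥ μ)) := by
  have hSu : IsUnit S.det := hS.det_pos.ne'.isUnit
  have hR : ∀ x y, x ⬝ᵥ ((S⁻¹ + M)⁻¹ *ᵥ y) = ((S⁻¹ + M)⁻¹ *ᵥ x) ⬝ᵥ y := fun x y => by
    rw [hQ.inv.isSymm.dotProduct_mulVec_comm, dotProduct_comm]
  have hP : ∀ x y, x ⬝ᵥ (S⁻¹ *ᵥ y) = (S⁻¹ *ᵥ x) ⬝ᵥ y := fun x y => by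
    rw [hS.inv.isSymm.dotProduct_mulVec_comm, dotProduct_comm]
  have hQR : ∀ x, (S⁻¹ + M) *ᵥ ((S⁻¹ + M)⁻¹ *ᵥ x) = x := fun x => by
    rw [mulVec_mulVec, mul_nonsing_inv _ hQ.det_pos.ne'.isUnit, one_mulVec]
  have hMSM : M * S * M = (S⁻¹ + M) * S * (S⁻¹ + M) - (S⁻¹ + M) - M := by
    rw [add_mul S⁻¹ M S, nonsing_inv_mul _ hSu, add_mul, mul_add (M * S), mul_assoc M S S⁻¹,
      mul_nonsing_inv _ hSu]
    simp only [one_mul, mul_one]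
    abel
  have hN' : S⁻¹ + N = (S⁻¹ + M) - M + N := by abel
  rw [hMSM, hN']
  simp only [← mulVec_mulVec, mulVec_add]
  rw [hR V, hR V, hP μ (_ *ᵥ (W - _)), hR (S⁻¹ *ᵥ μ), hP μ (_ *ᵥ (_ *ᵥ _)), hR (S⁻¹ *ᵥ μ)]
  set u := (S⁻¹ + M)⁻¹ *ᵥ V
  set v := (S⁻¹ + M)⁻¹ *ᵥ (S⁻¹ *ᵥ μ)
  have hQu : (S⁻¹ + M) *ᵥ u = V := hQR V
  have hQv : (S⁻¹ + M) *ᵥ v = S⁻¹ *ᵥ μ := hQR _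
  have huv : u ⬝ᵥ (S⁻¹ *ᵥ μ) = v ⬝ᵥ V := by
    rw [← hQv, ← hQu, hQ.isSymm.dotProduct_mulVec_comm]
  have hSv : v ⬝ᵥ (((S⁻¹ + M) * S * (S⁻¹ + M)) *ᵥ v) = μ ⬝ᵥ (S⁻¹ *ᵥ μ) := by
    rw [← mulVec_mulVec, ← mulVec_mulVec, hQv, mulVec_mulVec _ S, mul_nonsing_inv _ hSu,
      one_mulVec, hQ.isSymm.dotProduct_mulVec_comm, hQv]
  generalize S⁻¹ + M = Q at *
  simp only [add_mulVec, sub_mulVec, dotProduct_add, add_dotProduct, dotProduct_sub, hQu, hQv, hSv]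
  rw [hM.dotProduct_mulVec_comm u v, hN.dotProduct_mulVec_comm u v, dotProduct_comm V u,
    dotProduct_comm V v, dotProduct_comm (S⁻¹ *ᵥ μ) u, dotProduct_comm (S⁻¹ *ᵥ μ) v, huv]
  ring

end LinearQuadratic

/-- The continuous-time certainty equivalent formula: the Gaussian-reweighted expectation `c`
equals the explicit linear-quadratic expression with trace correction. -/
theorem stmt_6 {Ω : Type*} [MeasurableSpace Ω] (P : Measure Ω) [IsProbabilityMeasure P]
    (d : ℕ) (X : Ω → Fin d → ℝ) (hX : Measurable X)
    (μ : Fin d → ℝ) (S : Matrix (Fin d) (Fin d) ℝ) (hS : S.PosDef)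
    (hGauss : IsGaussianVec P X μ S)
    (Pm : Matrix (Fin d) (Fin d) ℝ) (hPm : Pm = S⁻¹)
    (Mbar Mbj : Matrix (Fin d) (Fin d) ℝ) (hMbar : Mbar.IsSymm) (hMbj : Mbj.IsSymm)
    (hpd : (Pm + Mbar).PosDef)
    (Vbar Vbj : Fin d → ℝ)
    (Λ : ℝ) (hΛ : Λ = Real.log (∫ ω, gaussWeight X Mbar Vbar ω ∂P))
    (c : ℝ)
    (hc : c = (∫ ω, ((1 / 2) * (X ω ⬝ᵥ (Mbj *ᵥ X ω)) + X ω ⬝ᵥ Vbj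
            - (1 / 2) * (X ω ⬝ᵥ (Mbar *ᵥ X ω)) + X ω ⬝ᵥ Vbar - Λ) *
          gaussWeight X Mbar Vbar ω ∂P) / ∫ ω, gaussWeight X Mbar Vbar ω ∂P) :
    c = (1 / 2) * Real.log ((1 + S * Mbar).det)
        - (1 / 2) * Matrix.trace ((Mbar - Mbj) * (Pm + Mbar)⁻¹)
        + Vbar ⬝ᵥ ((Pm + Mbar)⁻¹ *ᵥ Vbj)
        + (1 / 2) * (Vbar ⬝ᵥ (((Pm + Mbar)⁻¹ * (Pm + Mbj) * (Pm + Mbar)⁻¹) *ᵥ Vbar))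
        + μ ⬝ᵥ ((Pm * (Pm + Mbar)⁻¹) *ᵥ (Vbj - ((Mbar - Mbj) * (Pm + Mbar)⁻¹) *ᵥ Vbar))
        + (1 / 2) * (μ ⬝ᵥ ((Pm * (Pm + Mbar)⁻¹ * (Mbar * S * Mbar + Mbj) *
            (Pm + Mbar)⁻¹ * Pm) *ᵥ μ)) := by
  subst hPm
  have hZ : ∫ ω, gaussWeight X Mbar Vbar ω ∂P
      = ∫ x, gaussianPdf d μ S x * Real.exp (-(1 / 2) * (x ⬝ᵥ (Mbar *ᵥ x)) + x ⬝ᵥ Vbar) :=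
    hGauss.integral_comp hX
      (F := fun x => Real.exp (-(1 / 2) * (x ⬝ᵥ (Mbar *ᵥ x)) + x ⬝ᵥ Vbar)) (by fun_prop)
  have hnum : ∫ ω, ((1 / 2) * (X ω ⬝ᵥ (Mbj *ᵥ X ω)) + X ω ⬝ᵥ Vbj
        - (1 / 2) * (X ω ⬝ᵥ (Mbar *ᵥ X ω)) + X ω ⬝ᵥ Vbar - Λ) * gaussWeight X Mbar Vbar ω ∂P
      = ∫ x, gaussianPdf d μ S x *
        ((-Λ + x ⬝ᵥ (Vbj + Vbar) + 1 / 2 * (x ⬝ᵥ ((Mbj - Mbar) *ᵥ x))) *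
          Real.exp (-(1 / 2) * (x ⬝ᵥ (Mbar *ᵥ x)) + x ⬝ᵥ Vbar)) := by
    rw [← hGauss.integral_comp hX
      (F := fun x => (-Λ + x ⬝ᵥ (Vbj + Vbar) + 1 / 2 * (x ⬝ᵥ ((Mbj - Mbar) *ᵥ x))) *
        Real.exp (-(1 / 2) * (x ⬝ᵥ (Mbar *ᵥ x)) + x ⬝ᵥ Vbar)) (by fun_prop)]
    refine integral_congr_ae (ae_of_all _ fun ω => ?_)
    simp only [gaussWeight, dotProduct_add, sub_mulVec, dotProduct_sub]
    ring
  have hdet : 0 < (1 + S * Mbar).det := by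
    rw [← det_mul_det_inv_add hS]
    exact mul_pos hS.det_pos hpd.det_pos
  rw [hZ, integral_gaussianPdf_mul_exp_quadratic hS hpd, Real.log_mul (by positivity)
    (Real.exp_ne_zero _), Real.log_exp, Real.log_inv, Real.log_sqrt hdet.le] at hΛ
  have hpos : ∫ x, gaussianPdf d μ S x *
      Real.exp (-(1 / 2) * (x ⬝ᵥ (Mbar *ᵥ x)) + x ⬝ᵥ Vbar) ≠ 0 := by
    rw [integral_gaussianPdf_mul_exp_quadratic hS hpd]
    positivity
  rw [hnum, hZ, integral_gaussianPdf_mul_quadratic_mul_exp hS hpd,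
    mul_div_cancel_left₀ _ hpos] at hc
  have htr : ((Mbj - Mbar) * (S⁻¹ + Mbar)⁻¹).trace
      = -((Mbar - Mbj) * (S⁻¹ + Mbar)⁻¹).trace := by
    rw [← trace_neg, ← neg_mul, neg_sub]
  have hexpand := tilted_quadratic_expansion hS hMbar hMbj hpd μ Vbar Vbj
  rw [hc, hΛ, htr]
  linarith
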